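/- arXiv:1911.09806 — 2 statements merged into one kernel-verified Lean document; each statement's English description precedes it below -/
import Mathlib

section
/- Consider a congestion game with n players in which every resource e has affine cost function ℓ_e(x)=α_e·x+β_e with α_e,β_e ≥ 0, and the marginal-cost toll τ_e(x)=α_e·(x−1). Then for every pure Nash equilibrium a and every feasible allocation a′ it holds that SC(a) ≤ 3·SC(a′). -/
/-- Number of players using resource `e` in allocation `a`. -/
def cgLoad {n : ℕ} {E : Type*} [DecidableEq E] (a : Fin n → Finset E) (e : E) : ℕ :=
  (Finset.univ.filter fun i => e ∈ a i).card

/-- Social cost `SC(a) = Σ_e |a|_e · ℓ_e(|a|_e)`. -/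
def cgSocialCost {n : ℕ} {E : Type*} [DecidableEq E] [Fintype E] (cost : E → ℕ → ℝ)
    (a : Fin n → Finset E) : ℝ :=
  ∑ e, (cgLoad a e : ℝ) * cost e (cgLoad a e)

/-- Cost of player `i`: `C_i(a) = Σ_{e ∈ a_i} [ℓ_e(|a|_e) + τ_e(|a|_e)]`. -/
def cgPlayerCost {n : ℕ} {E : Type*} [DecidableEq E] (cost toll : E → ℕ → ℝ)
    (a : Fin n → Finset E) (i : Fin n) : ℝ :=
  ∑ e ∈ a i, (cost e (cgLoad a e) + toll e (cgLoad a e))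

/-- `a` is a pure Nash equilibrium of the congestion game with action sets `A`,
resource costs `cost` and tolls `toll`. -/
def cgIsNash {n : ℕ} {E : Type*} [DecidableEq E] (A : Fin n → Set (Finset E))
    (cost toll : E → ℕ → ℝ) (a : Fin n → Finset E) : Prop :=
  ∀ i : Fin n, ∀ b ∈ A i,
    cgPlayerCost cost toll a i ≤ cgPlayerCost cost toll (Function.update a i b) i

/-- Summing over players the total weight of their resources counts each resource by its load. -/
theorem sum_sum_mem_eq_sum_cgLoad_mul {n : ℕ} {E : Type*} [DecidableEq E] [Fintype E]
    (a : Fin n → Finset E) (f : E → ℝ) :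
    ∑ i, ∑ e ∈ a i, f e = ∑ e, (cgLoad a e : ℝ) * f e := by
  calc ∑ i, ∑ e ∈ a i, f e = ∑ i, ∑ e, if e ∈ a i then f e else 0 := by simp
    _ = ∑ e, ∑ i, if e ∈ a i then f e else 0 := Finset.sum_comm
    _ = ∑ e, (cgLoad a e : ℝ) * f e := by
      simp [cgLoad, ← Finset.sum_filter]

/-- A unilateral deviation raises the load of a resource by at most one. -/
theorem cgLoad_update_le {n : ℕ} {E : Type*} [DecidableEq E]
    (a : Fin n → Finset E) (i : Fin n) (b : Finset E) (e : E) :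
    cgLoad (Function.update a i b) e ≤ cgLoad a e + 1 := by
  refine (Finset.card_le_card (t := insert i (Finset.univ.filter fun j => e ∈ a j)) ?_).trans
    (Finset.card_insert_le _ _)
  intro j hj
  by_cases h : j = i <;> simp_all

/-- The smoothness inequality for the quadratic part of the social cost. -/
theorem nat_sq_add_deviation_le (x y : ℕ) :
    (x : ℝ) ^ 2 + y * (2 * x + 1) ≤ x * (2 * x - 1) + 3 * (y : ℝ) ^ 2 := by
  have h : (x : ℤ) ^ 2 + y * (2 * x + 1) ≤ x * (2 * x - 1) + 3 * (y : ℤ) ^ 2 := by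
    nlinarith [Int.le_self_sq ((x : ℤ) - y), Int.le_self_sq y]
  exact_mod_cast h

/-- with affine resource costs `ℓ_e(x) = α_e x + β_e` (nonnegative
coefficients) and the marginal-cost toll `τ_e(x) = α_e (x−1)`, every pure Nash
equilibrium `a` satisfies `SC(a) ≤ 3·SC(a')` for every feasible allocation `a'`. -/
theorem marginal_toll_affine_poa
    {n : ℕ} {E : Type*} [DecidableEq E] [Fintype E]
    (A : Fin n → Set (Finset E)) (α β : E → ℝ)
    (hα : ∀ e, 0 ≤ α e) (hβ : ∀ e, 0 ≤ β e)
    (cost toll : E → ℕ → ℝ)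
    (hcost : ∀ e (x : ℕ), cost e x = α e * (x : ℝ) + β e)
    (htoll : ∀ e (x : ℕ), toll e x = α e * ((x : ℝ) - 1))
    (a a' : Fin n → Finset E)
    (ha : ∀ i, a i ∈ A i) (ha' : ∀ i, a' i ∈ A i)
    (hNash : cgIsNash A cost toll a) :
    cgSocialCost cost a ≤ 3 * cgSocialCost cost a' := by
  have key : ∑ i, ∑ e ∈ a i, (α e * (2 * (cgLoad a e : ℝ) - 1) + β e) ≤
      ∑ i, ∑ e ∈ a' i, (α e * (2 * (cgLoad a e : ℝ) + 1) + β e) := by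
    refine Finset.sum_le_sum fun i _ => ?_
    have h := hNash i (a' i) (ha' i)
    simp only [cgPlayerCost, hcost, htoll, Function.update_self] at h
    calc ∑ e ∈ a i, (α e * (2 * (cgLoad a e : ℝ) - 1) + β e)
        = ∑ e ∈ a i, (α e * (cgLoad a e : ℝ) + β e + α e * ((cgLoad a e : ℝ) - 1)) :=
          Finset.sum_congr rfl fun e _ => by ring
      _ ≤ _ := h
      _ ≤ ∑ e ∈ a' i, (α e * (2 * (cgLoad a e : ℝ) + 1) + β e) := by
          refine Finset.sum_le_sum fun e _ => ?_
          have hl : (cgLoad (Function.update a i (a' i)) e : ℝ) ≤ cgLoad a e + 1 := by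
            exact_mod_cast cgLoad_update_le a i (a' i) e
          nlinarith [mul_le_mul_of_nonneg_left hl (hα e)]
  rw [sum_sum_mem_eq_sum_cgLoad_mul, sum_sum_mem_eq_sum_cgLoad_mul] at key
  have smooth : cgSocialCost cost a +
        ∑ e, (cgLoad a' e : ℝ) * (α e * (2 * (cgLoad a e : ℝ) + 1) + β e) ≤
      ∑ e, (cgLoad a e : ℝ) * (α e * (2 * (cgLoad a e : ℝ) - 1) + β e) +
        3 * cgSocialCost cost a' := by
    simp only [cgSocialCost, hcost]
    rw [Finset.mul_sum, ← Finset.sum_add_distrib, ← Finset.sum_add_distrib]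
    refine Finset.sum_le_sum fun e _ => ?_
    have hβy : 0 ≤ β e * (cgLoad a' e : ℝ) := mul_nonneg (hβ e) (Nat.cast_nonneg _)
    linarith [mul_le_mul_of_nonneg_left
      (nat_sq_add_deviation_le (cgLoad a e) (cgLoad a' e)) (hα e)]
  linarith
end

section
/- Let n ≥ 2 be an integer and let b:{1,…,n}→ℝ be positive, strictly increasing, and discretely convex. With β(u,v)=min{u,n−v}/min{v,n−u}, γ(u,v)=b(v)·v/min{v,n−u}, δ(u,v)=b(u)·u/min{v,n−u}, let ρ* = min over (v_1,…,v_n)∈{1,…,n}^{n−1}×{0,…,n} of N/D, where (writing β_u=β(u,v_u), γ_u=γ(u,v_u), δ_u=δ(u,v_u)) N = (n−v_n)·( b(1)·∏_{u=1}^{n−1}β_u + Σ_{u=1}^{n−2}(∏_{i=u+1}^{n−1}β_i)·γ_u + γ_{n−1} ) + b(v_n)·v_n and D = (n−v_n)·( Σ_{u=1}^{n−2}(∏_{i=u+1}^{n−1}β_i)·δ_u + δ_{n−1} ) + b(n)·n, and let f*:{1,…,n}→ℝ be defined by f*(1)=b(1) and f*(u+1) = min over v∈{1,…,n} of [β(u,v)·f*(u)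 + γ(u,v) − δ(u,v)·ρ*]. Then f* is nondecreasing: f*(u+1) ≥ f*(u) for all u∈{1,…,n−1}. -/
/-- `β(u,v) = min{u, n−v} / min{v, n−u}`. -/
noncomputable def betaC (n u w : ℕ) : ℝ :=
  ((min u (n - w) : ℕ) : ℝ) / ((min w (n - u) : ℕ) : ℝ)

/-- `γ(u,v) = b(v)·v / min{v, n−u}`. -/
noncomputable def gammaC (n : ℕ) (b : ℕ → ℝ) (u w : ℕ) : ℝ :=
  b w * (w : ℝ) / ((min w (n - u) : ℕ) : ℝ)

/-- `δ(u,v) = b(u)·u / min{v, n−u}`. -/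
noncomputable def deltaC (n : ℕ) (b : ℕ → ℝ) (u w : ℕ) : ℝ :=
  b u * (u : ℝ) / ((min w (n - u) : ℕ) : ℝ)

/-- The numerator `N` in the definition of `ρ*`. -/
noncomputable def Nval (n : ℕ) (b : ℕ → ℝ) (v : ℕ → ℕ) : ℝ :=
  ((n : ℝ) - (v n : ℝ)) *
      (b 1 * ∏ u ∈ Finset.Icc 1 (n - 1), betaC n u (v u) +
        ∑ u ∈ Finset.Icc 1 (n - 2),
          (∏ i ∈ Finset.Icc (u + 1) (n - 1), betaC n i (v i)) * gammaC n b u (v u) +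
        gammaC n b (n - 1) (v (n - 1))) +
    b (v n) * (v n : ℝ)

/-- The denominator `D` in the definition of `ρ*`. -/
noncomputable def Dval (n : ℕ) (b : ℕ → ℝ) (v : ℕ → ℕ) : ℝ :=
  ((n : ℝ) - (v n : ℝ)) *
      (∑ u ∈ Finset.Icc 1 (n - 2),
          (∏ i ∈ Finset.Icc (u + 1) (n - 1), betaC n i (v i)) * deltaC n b u (v u) +
        deltaC n b (n - 1) (v (n - 1))) +
    b n * (n : ℝ)

/-- Tuples `(v_1,…,v_n) ∈ {1,…,n}^{n−1} × {0,…,n}`, encoded as functions `ℕ → ℕ`. -/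
def TupleSet (n : ℕ) : Set (ℕ → ℕ) :=
  {v | (∀ u, 1 ≤ u → u ≤ n - 1 → 1 ≤ v u ∧ v u ≤ n) ∧ v n ≤ n}

/-- The two truncated minima appearing in `betaC` differ by `u - w`. -/
theorem cast_min_sub_cast_min {n u w : ℕ} (hu : u ≤ n) (hw : w ≤ n) :
    ((min u (n - w) : ℕ) : ℝ) = ((min w (n - u) : ℕ) : ℝ) + u - w := by
  have h : min u (n - w) + w = min w (n - u) + u := by omega
  have h' : ((min u (n - w) : ℕ) : ℝ) + w = ((min w (n - u) : ℕ) : ℝ) + u := by exact_mod_cast h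
  linarith

theorem betaC_nonneg (n u w : ℕ) : 0 ≤ betaC n u w := by
  unfold betaC; positivity

theorem gammaC_nonneg {n : ℕ} {b : ℕ → ℝ} {w : ℕ} (u : ℕ) (hb : 0 ≤ b w) :
    0 ≤ gammaC n b u w := by
  unfold gammaC; positivity

theorem deltaC_nonneg {n : ℕ} {b : ℕ → ℝ} {u : ℕ} (w : ℕ) (hb : 0 ≤ b u) :
    0 ≤ deltaC n b u w := by
  unfold deltaC; positivity

/-- Closed form of an affine recursion. -/
theorem affine_recursion_closed_form (β a f : ℕ → ℝ) (m : ℕ)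
    (h : ∀ u, 1 ≤ u → u ≤ m → f (u + 1) = β u * f u + a u) :
    f (m + 1) = f 1 * ∏ u ∈ Finset.Icc 1 m, β u +
      ∑ u ∈ Finset.Icc 1 m, (∏ i ∈ Finset.Icc (u + 1) m, β i) * a u := by
  induction m with
  | zero => simp
  | succ m ih =>
    have ih' := ih fun u h1 h2 => h u h1 (by omega)
    rw [h (m + 1) (by omega) le_rfl, ih', Finset.prod_Icc_succ_top (by omega),
      Finset.sum_Icc_succ_top (by omega)]
    have hs : ∑ u ∈ Finset.Icc 1 m, (∏ i ∈ Finset.Icc (u + 1) (m + 1), β i) * a u =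
        β (m + 1) * ∑ u ∈ Finset.Icc 1 m, (∏ i ∈ Finset.Icc (u + 1) m, β i) * a u := by
      rw [Finset.mul_sum]
      refine Finset.sum_congr rfl fun u hu => ?_
      rw [Finset.prod_Icc_succ_top (by have := (Finset.mem_Icc.mp hu).2; omega)]
      ring
    rw [hs]
    simp
    ring

/-- A discretely convex function lies above its left tangent lines. -/
theorem tangent_le_of_convex {n : ℕ} {c : ℕ → ℝ}
    (hc : ∀ x, x + 2 ≤ n → c (x + 1) - c x ≤ c (x + 2) - c (x + 1))
    {t v : ℕ} (ht : t + 1 ≤ n) (hv : v ≤ n) :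
    c (t + 1) + ((v : ℝ) - ((t + 1 : ℕ) : ℝ)) * (c (t + 1) - c t) ≤ c v := by
  have mono : ∀ x d, x + d + 1 ≤ n → c (x + 1) - c x ≤ c (x + d + 1) - c (x + d) := by
    intro x d
    induction d with
    | zero => intro _; exact le_rfl
    | succ d ih =>
      intro h
      exact (ih (by omega)).trans (hc (x + d) (by omega))
  rcases le_total v (t + 1) with h | h
  · obtain ⟨d, hd⟩ := Nat.exists_eq_add_of_le h
    induction d generalizing v with
    | zero => simp [hd]
    | succ d ih =>
      have h1 := ih (v := v + 1) (by omega) (by omega) (by omega)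
      have h2 := mono v d (by omega)
      obtain rfl : t = v + d := by omega
      push_cast at h1 h2 ⊢
      linarith
  · obtain ⟨d, rfl⟩ := Nat.exists_eq_add_of_le h
    clear h
    induction d with
    | zero => simp
    | succ d ih =>
      have h1 := ih (by omega)
      have h2 := mono t (d + 1) (by omega)
      have e1 : t + (d + 1) + 1 = t + 1 + (d + 1) := by omega
      have e2 : t + (d + 1) = t + 1 + d := by omega
      rw [e1, e2] at h2
      push_cast at h1 h2 ⊢
      linarith

/-- If the inequality characterising `f u ≤ f (u + 1)` fails at `u` while `f u` is below `ρ` times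
the slope of `c` at `u`, then it also fails at `n`. -/
theorem violation_propagates {n : ℕ} {c f : ℕ → ℝ} {ρ : ℝ} (hρ0 : 0 ≤ ρ)
    (hc : ∀ x, x + 2 ≤ n → c (x + 1) - c x ≤ c (x + 2) - c (x + 1))
    (hrec : ∀ u w, 1 ≤ u → u + 1 ≤ n → 1 ≤ w → w ≤ n →
      ((min w (n - u) : ℕ) : ℝ) * f (u + 1) ≤
        ((min u (n - w) : ℕ) : ℝ) * f u + c w - ρ * c u)
    {t v : ℕ} (ht : t + 1 ≤ n) (hv1 : 1 ≤ v) (hv : v ≤ t + 1)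
    (hf : f (t + 1) ≤ ρ * (c (t + 1) - c t))
    (hfail : (((t + 1 : ℕ) : ℝ) - v) * f (t + 1) + c v < ρ * c (t + 1)) :
    ((n : ℝ) - v) * f n + c v < ρ * c n := by
  obtain ⟨d, rfl⟩ := Nat.exists_eq_add_of_le ht
  suffices H : ∀ e, e ≤ d → f (t + 1 + e) ≤ ρ * (c (t + 1 + e) - c (t + e)) ∧
      (((t + 1 + e : ℕ) : ℝ) - v) * f (t + 1 + e) + c v < ρ * c (t + 1 + e) from (H d le_rfl).2
  intro e
  induction e with
  | zero => intro _; exact ⟨hf, hfail⟩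
  | succ e ih =>
    intro he
    obtain ⟨h1, h2⟩ := ih (by omega)
    have e1 : t + (e + 1) = t + 1 + e := by omega
    have e2 : t + 1 + (e + 1) = t + 1 + e + 1 := by omega
    have hs := hc (t + e) (by omega)
    rw [show t + e + 1 = t + 1 + e by omega, show t + e + 2 = t + 1 + e + 1 by omega] at hs
    rw [e1, e2]
    set k := t + 1 + e with hk
    have hr := hrec k v (by omega) (by omega) hv1 (by omega)
    rw [cast_min_sub_cast_min (u := k) (w := v) (by omega) (by omega)] at hr
    have hM : (0 : ℝ) < ((min v (t + 1 + d - k) : ℕ) : ℝ) := by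
      have : 0 < min v (t + 1 + d - k) := by omega
      exact_mod_cast this
    have hdec : f (k + 1) ≤ f k := by
      refine le_of_mul_le_mul_left ?_ hM
      linarith
    have hs' := mul_le_mul_of_nonneg_left hs hρ0
    have hkv : (0 : ℝ) ≤ (k : ℝ) + 1 - v := by
      have : (v : ℝ) ≤ k + 1 := by exact_mod_cast (by omega : v ≤ k + 1)
      linarith
    have hm := mul_le_mul_of_nonneg_left hdec hkv
    push_cast
    constructor <;> linarith

/-- The inequality characterising `f u ≤ f (u + 1)` holds for every `u ≤ n` as soon as it
holds at `n`. -/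
theorem convex_recursion_inequality {n : ℕ} {c f : ℕ → ℝ} {ρ : ℝ}
    (hρ0 : 0 ≤ ρ) (hρ1 : ρ ≤ 1) (hc0 : c 0 = 0) (hcnn : ∀ x, x ≤ n → 0 ≤ c x)
    (hc : ∀ x, x + 2 ≤ n → c (x + 1) - c x ≤ c (x + 2) - c (x + 1))
    (hf1 : f 1 = c 1)
    (hrec : ∀ u w, 1 ≤ u → u + 1 ≤ n → 1 ≤ w → w ≤ n →
      ((min w (n - u) : ℕ) : ℝ) * f (u + 1) ≤
        ((min u (n - w) : ℕ) : ℝ) * f u + c w - ρ * c u)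
    (hmono : ∀ u, 1 ≤ u → u + 1 ≤ n →
      (∀ w, 1 ≤ w → w ≤ n → ρ * c u ≤ ((u : ℝ) - w) * f u + c w) → f u ≤ f (u + 1))
    (hend : ∀ w, 1 ≤ w → w ≤ n → ρ * c n ≤ ((n : ℝ) - w) * f n + c w)
    (t : ℕ) (ht : t + 1 ≤ n) :
    ∀ w, 1 ≤ w → w ≤ n → ρ * c (t + 1) ≤ (((t + 1 : ℕ) : ℝ) - w) * f (t + 1) + c w := by
  induction t with
  | zero =>
    intro w hw1 hw
    have h := tangent_le_of_convex hc ht hw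
    have h1 := mul_le_mul_of_nonneg_right hρ1 (hcnn 1 (by omega))
    simp only [zero_add, hf1, hc0, sub_zero] at h ⊢
    linarith
  | succ t ih =>
    have hinc := hmono (t + 1) (by omega) ht (ih (by omega))
    intro v hv1 hv
    by_contra! hfail
    have htan := mul_le_mul_of_nonneg_left (tangent_le_of_convex hc ht hv) hρ0
    have hρv := mul_le_mul_of_nonneg_right hρ1 (hcnn v hv)
    have hρu := mul_le_mul_of_nonneg_right hρ1 (hcnn (t + 1 + 1) ht)
    have hlow : f (t + 1 + 1) < ρ * (c (t + 1 + 1) - c (t + 1)) := by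
      by_contra! hge
      rcases le_total v (t + 1 + 1) with h | h
      · have hd : (0 : ℝ) ≤ ((t + 1 + 1 : ℕ) : ℝ) - v := sub_nonneg.mpr (by exact_mod_cast h)
        have := mul_le_mul_of_nonneg_left hge hd
        linarith
      · have hr := hrec (t + 1) v (by omega) ht hv1 hv
        have hm := mul_le_mul_of_nonneg_left hinc
          (Nat.cast_nonneg (α := ℝ) (min (t + 1) (n - v)))
        have he := cast_min_sub_cast_min (show t + 1 ≤ n by omega) hv
        rw [he] at hr hm
        push_cast at hr hm hfail
        linarith
    have hvu : v ≤ t + 1 + 1 := by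
      by_contra! h
      have hd : (0 : ℝ) ≤ v - ((t + 1 + 1 : ℕ) : ℝ) := sub_nonneg.mpr (by exact_mod_cast h.le)
      have := mul_le_mul_of_nonneg_left hlow.le hd
      linarith
    exact absurd (hend v hv1 hv)
      (not_le.mpr (violation_propagates hρ0 hc hrec ht hv1 hvu hlow.le hfail))

theorem Nval_nonneg {n : ℕ} (hn : 2 ≤ n) {b : ℕ → ℝ} (hb : ∀ x, 1 ≤ x → x ≤ n → 0 < b x)
    {v : ℕ → ℕ} (hv : v ∈ TupleSet n) : 0 ≤ Nval n b v := by
  obtain ⟨hv1, hvn⟩ := hv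
  have hγ : ∀ u, 1 ≤ u → u ≤ n - 1 → 0 ≤ gammaC n b u (v u) := fun u h1 h2 =>
    gammaC_nonneg u (hb _ (hv1 u h1 h2).1 (hv1 u h1 h2).2).le
  have hlast : 0 ≤ b (v n) * (v n : ℝ) := by
    rcases Nat.eq_zero_or_pos (v n) with h | h
    · simp [h]
    · exact mul_nonneg (hb _ h hvn).le (Nat.cast_nonneg _)
  refine add_nonneg (mul_nonneg (sub_nonneg.mpr (by exact_mod_cast hvn))
    (add_nonneg (add_nonneg ?_ ?_) (hγ _ (by omega) le_rfl))) hlast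
  · exact mul_nonneg (hb 1 le_rfl (by omega)).le
      (Finset.prod_nonneg fun _ _ => betaC_nonneg _ _ _)
  · refine Finset.sum_nonneg fun u hu => ?_
    have := Finset.mem_Icc.mp hu
    exact mul_nonneg (Finset.prod_nonneg fun _ _ => betaC_nonneg _ _ _)
      (hγ u this.1 (by omega))

theorem Dval_pos {n : ℕ} (hn : 2 ≤ n) {b : ℕ → ℝ} (hb : ∀ x, 1 ≤ x → x ≤ n → 0 < b x)
    {v : ℕ → ℕ} (hv : v ∈ TupleSet n) : 0 < Dval n b v := by
  obtain ⟨-, hvn⟩ := hv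
  have hδ : ∀ u, 1 ≤ u → u ≤ n - 1 → 0 ≤ deltaC n b u (v u) := fun u h1 h2 =>
    deltaC_nonneg _ (hb u h1 (by omega)).le
  refine add_pos_of_nonneg_of_pos (mul_nonneg (sub_nonneg.mpr (by exact_mod_cast hvn))
    (add_nonneg (Finset.sum_nonneg fun u hu => ?_) (hδ _ (by omega) le_rfl)))
    (mul_pos (hb n (by omega) le_rfl) (by exact_mod_cast (by omega : 0 < n)))
  have := Finset.mem_Icc.mp hu
  exact mul_nonneg (Finset.prod_nonneg fun _ _ => betaC_nonneg _ _ _) (hδ u this.1 (by omega))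

/-- Along a tuple `v` that realises the recursion for `f`, the value `N - ρ D` is
the final constraint at `v n`. -/
theorem Nval_sub_mul_Dval {n : ℕ} (hn : 2 ≤ n) {b f : ℕ → ℝ} {ρ : ℝ} {v : ℕ → ℕ}
    (hf1 : f 1 = b 1)
    (hf : ∀ u, 1 ≤ u → u ≤ n - 1 → f (u + 1) =
      betaC n u (v u) * f u + gammaC n b u (v u) - deltaC n b u (v u) * ρ) :
    Nval n b v - ρ * Dval n b v =
      ((n : ℝ) - v n) * f n + b (v n) * v n - ρ * (b n * n) := by
  obtain ⟨m, rfl⟩ := Nat.exists_eq_add_of_le' hn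
  have h := affine_recursion_closed_form (fun u => betaC (m + 2) u (v u))
    (fun u => gammaC (m + 2) b u (v u) - deltaC (m + 2) b u (v u) * ρ) f (m + 1)
    (fun u h1 h2 => by rw [hf u h1 (by omega)]; ring)
  rw [Finset.sum_Icc_succ_top (by omega)] at h
  simp only [mul_sub, Finset.sum_sub_distrib, ← mul_assoc, ← Finset.sum_mul] at h
  rw [show m + 1 + 1 = m + 2 from rfl, hf1] at h
  rw [h, Nval, Dval, show m + 2 - 1 = m + 1 from rfl, show m + 2 - 2 = m from rfl]
  simp only [Finset.Icc_eq_empty (show ¬ m + 2 ≤ m + 1 by omega), Finset.prod_empty]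
  ring

/-- the function `f*` defined by the recursion is nondecreasing. -/
theorem fstar_nondecreasing
    (n : ℕ) (hn : 2 ≤ n) (b : ℕ → ℝ)
    (hbpos : ∀ x, 1 ≤ x → x ≤ n → 0 < b x)
    (hbmono : ∀ x, 1 ≤ x → x + 1 ≤ n → b x < b (x + 1))
    (hbconv : ∀ x, 1 ≤ x → x + 2 ≤ n → b (x + 1) - b x ≤ b (x + 2) - b (x + 1))
    (ρstar : ℝ)
    (hρ : IsLeast {r : ℝ | ∃ v ∈ TupleSet n, r = Nval n b v / Dval n b v} ρstar)
    (fstar : ℕ → ℝ)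
    (hf1 : fstar 1 = b 1)
    (hfrec : ∀ u, 1 ≤ u → u + 1 ≤ n →
      fstar (u + 1) = (Finset.Icc 1 n).inf' (Finset.nonempty_Icc.mpr (by omega))
        (fun w => betaC n u w * fstar u + gammaC n b u w - deltaC n b u w * ρstar)) :
    ∀ u, 1 ≤ u → u + 1 ≤ n → fstar u ≤ fstar (u + 1) := by
  have hcast : ∀ u w, 1 ≤ w → u + 1 ≤ n → (0 : ℝ) < ((min w (n - u) : ℕ) : ℝ) := by
    intro u w h1 h2
    have : 0 < min w (n - u) := by omega
    exact_mod_cast this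
  have hstep : ∀ u w x, 1 ≤ w → u + 1 ≤ n →
      betaC n u w * x + gammaC n b u w - deltaC n b u w * ρstar =
        (((min u (n - w) : ℕ) : ℝ) * x + b w * w - ρstar * (b u * u)) /
          ((min w (n - u) : ℕ) : ℝ) := by
    intro u w x _ _
    unfold betaC gammaC deltaC
    ring
  have hρ0 : 0 ≤ ρstar := by
    obtain ⟨v, hv, hr⟩ := hρ.1
    rw [hr]
    exact div_nonneg (Nval_nonneg hn hbpos hv) (Dval_pos hn hbpos hv).le
  have hle : ∀ v ∈ TupleSet n, ρstar * Dval n b v ≤ Nval n b v := fun v hv =>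
    (le_div_iff₀ (Dval_pos hn hbpos hv)).mp (hρ.2 ⟨v, hv, rfl⟩)
  have hρ1 : ρstar ≤ 1 := by
    have h := hle (fun _ => n) ⟨fun _ _ _ => ⟨one_le_two.trans hn, le_rfl⟩, le_rfl⟩
    have hpos : 0 < b n * (n : ℝ) :=
      mul_pos (hbpos n (by omega) le_rfl) (by exact_mod_cast (by omega : 0 < n))
    simp only [Nval, Dval, sub_self, zero_mul, zero_add] at h
    exact le_of_mul_le_mul_right (by linarith) hpos
  have hmin : ∀ u, ∃ w, 1 ≤ u → u + 1 ≤ n → (1 ≤ w ∧ w ≤ n) ∧ fstar (u + 1) =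
      betaC n u w * fstar u + gammaC n b u w - deltaC n b u w * ρstar := by
    intro u
    by_cases h : 1 ≤ u ∧ u + 1 ≤ n
    · obtain ⟨w, hw, he⟩ := Finset.exists_mem_eq_inf'
        (Finset.nonempty_Icc.mpr (by omega : 1 ≤ n))
        (fun w => betaC n u w * fstar u + gammaC n b u w - deltaC n b u w * ρstar)
      exact ⟨w, fun h1 h2 => ⟨Finset.mem_Icc.mp hw, (hfrec u h1 h2).trans he⟩⟩
    · exact ⟨0, fun h1 h2 => absurd ⟨h1, h2⟩ h⟩
  choose s hs using hmin
  have hend : ∀ w, 1 ≤ w → w ≤ n →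
      ρstar * (b n * n) ≤ ((n : ℝ) - w) * fstar n + b w * w := by
    intro w _ hw
    have hne : ∀ u, u ≤ n - 1 → Function.update s n w u = s u := fun u hu =>
      Function.update_of_ne (by omega) _ _
    have hN := hle (Function.update s n w) ⟨fun u h1 h2 => by
      rw [hne u h2]; exact (hs u h1 (by omega)).1, by simpa using hw⟩
    have he := Nval_sub_mul_Dval hn (ρ := ρstar) (v := Function.update s n w) hf1
      (fun u h1 h2 => by rw [hne u h2]; exact (hs u h1 (by omega)).2)
    rw [Function.update_self] at he
    linarith
  have hmono : ∀ u, 1 ≤ u → u + 1 ≤ n → (∀ w, 1 ≤ w → w ≤ n →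
      ρstar * (b u * u) ≤ ((u : ℝ) - w) * fstar u + b w * w) → fstar u ≤ fstar (u + 1) := by
    intro u h1 h2 h
    obtain ⟨⟨hw1, hw2⟩, he⟩ := hs u h1 h2
    rw [he, hstep _ _ _ hw1 h2, le_div_iff₀ (hcast _ _ hw1 h2),
      cast_min_sub_cast_min (by omega) hw2]
    linarith [h _ hw1 hw2]
  intro u hu1 hun
  refine hmono u hu1 hun ?_
  obtain ⟨t, rfl⟩ := Nat.exists_eq_add_of_le' hu1
  refine convex_recursion_inequality (c := fun x => b x * (x : ℝ)) hρ0 hρ1 (by simp) ?_ ?_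
    (by simp [hf1]) ?_ hmono hend t (by omega)
  · intro x hx
    rcases Nat.eq_zero_or_pos x with h | h
    · simp [h]
    · exact mul_nonneg (hbpos x h hx).le (Nat.cast_nonneg _)
  · intro x hx
    have h1 := hbmono (x + 1) (by omega) hx
    rcases Nat.eq_zero_or_pos x with rfl | h
    · norm_num at h1 ⊢
      linarith
    · have h2 := hbmono x h (by omega)
      have h3 := mul_nonneg (sub_nonneg.mpr (hbconv x h hx)) (Nat.cast_nonneg (α := ℝ) x)
      push_cast
      rw [show x + 1 + 1 = x + 2 from rfl] at h1
      linarith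
  · intro v w h1 h2 hw1 hw2
    have hw := (hfrec v h1 h2).trans_le (Finset.inf'_le _ (Finset.mem_Icc.mpr ⟨hw1, hw2⟩))
    rw [hstep _ _ _ hw1 h2, le_div_iff₀ (hcast _ _ hw1 h2)] at hw
    linarith
end
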